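/- arXiv:1202.3965 — 2 statements merged into one kernel-verified Lean document; each statement's English description precedes it below -/
import Mathlib

section
/- There exists a constant C > 0 such that for every integer n ≥ 2 there is a constant C_n with N_n(X) ≤ C_n·X^{exp(C·√(log n))} for all X ≥ 2. -/
/-- A number field of degree `n` over `ℚ`. -/
structure NFieldDeg (n : ℕ) where
  carrier : Type
  [field : Field carrier]
  [nf : NumberField carrier]
  deg : Module.finrank ℚ carrier = n

attribute [instance] NFieldDeg.field NFieldDeg.nf

/-- Two number fields of degree `n` are identified if they are isomorphic. -/
instance NFieldDeg.setoid (n : ℕ) : Setoid (NFieldDeg n) where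
  r A B := Nonempty (A.carrier ≃+* B.carrier)
  iseqv := ⟨fun _ => ⟨RingEquiv.refl _⟩, fun ⟨e⟩ => ⟨e.symm⟩, fun ⟨e⟩ ⟨f⟩ => ⟨e.trans f⟩⟩

/-- `N_n(X)`: the number of isomorphism classes of degree-`n` number fields with
`|Disc(K)| < X`. -/
noncomputable def countDegN (n : ℕ) (X : ℝ) : ℕ :=
  Nat.card {C : Quotient (NFieldDeg.setoid n) //
    ∃ K : NFieldDeg n, ⟦K⟧ = C ∧ |(NumberField.discr K.carrier : ℝ)| < X}

section

open NumberField NumberField.mixedEmbedding MeasureTheory Module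

/-- The real coordinates of `x` with respect to the standard basis of the mixed space. -/
noncomputable def realCoord (K : Type*) [Field K] [NumberField K] : K →ₗ[ℚ] (index K → ℝ) :=
  AddMonoidHom.toRatLinearMap
    { toFun := fun x => (stdBasis K).equivFun (mixedEmbedding K x)
      map_zero' := by simp
      map_add' := fun x y => by simp }

theorem realCoord_apply {K : Type*} [Field K] [NumberField K] (x : K) (i : index K) :
    realCoord K x i = (stdBasis K).repr (mixedEmbedding K x) i := rfl

open scoped Classical in
theorem card_index (K : Type*) [Field K] [NumberField K] :
    Fintype.card (index K) = finrank ℚ K := by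
  rw [← mixedEmbedding.finrank K, finrank_eq_card_basis (stdBasis K)]

open scoped Classical in
/-- Minkowski's theorem for the box with half-sides `B i` in the mixed space. -/
theorem exists_ne_zero_abs_realCoord_lt {K : Type*} [Field K] [NumberField K] (B : index K → ℝ)
    (hB : ∀ i, 0 < B i) (h : 2 ^ finrank ℚ K * √|(discr K : ℝ)| < ∏ i, B i) :
    ∃ x : K, IsIntegral ℤ x ∧ x ≠ 0 ∧ ∀ i, |realCoord K x i| < B i := by
  have h_fund := ZSpan.isAddFundamentalDomain' (latticeBasis K) volume
  have : Countable (Submodule.span ℤ (Set.range (latticeBasis K))).toAddSubgroup := by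
    change Countable (Submodule.span ℤ (Set.range (latticeBasis K)))
    infer_instance
  let s : Set (mixedSpace K) := {x | ∀ i, |(stdBasis K).repr x i| < B i}
  have hs_neg : ∀ x ∈ s, -x ∈ s := fun x hx i => by simpa using hx i
  have hs_conv : Convex ℝ s := by
    have : s = (stdBasis K).equivFun ⁻¹' (Set.univ.pi fun i => Set.Ioo (-B i) (B i)) := by
      ext x
      simp [s, abs_lt]
    rw [this]
    exact (convex_pi fun i _ => convex_Ioo _ _).linear_preimage
      (stdBasis K).equivFun.toLinearMap
  have hunit : ∀ i, IsUnit (B i) := fun i => (hB i).ne'.isUnit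
  have hsub : ZSpan.fundamentalDomain ((stdBasis K).isUnitSMul hunit) ⊆ s := by
    intro x hx i
    have := (ZSpan.mem_fundamentalDomain _).1 hx i
    rw [Basis.repr_isUnitSMul, Units.smul_def, smul_eq_mul, Units.val_inv_eq_inv_val,
      IsUnit.unit_spec, Set.mem_Ico, inv_mul_lt_iff₀ (hB i), mul_one] at this
    rw [abs_of_nonneg (by simpa [hB i] using this.1)]
    exact this.2
  have hvol : volume (ZSpan.fundamentalDomain ((stdBasis K).isUnitSMul hunit)) =
      ENNReal.ofReal (∏ i, B i) := by
    rw [ZSpan.measure_fundamentalDomain _ _ (stdBasis K), volume_fundamentalDomain_stdBasis,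
      mul_one, Basis.det_apply, Basis.toMatrix_isUnitSMul, Matrix.det_diagonal,
      abs_of_pos (Finset.prod_pos fun i _ => hB i)]
  have hle : volume (ZSpan.fundamentalDomain (latticeBasis K)) ≤
      ENNReal.ofReal (√|(discr K : ℝ)|) := by
    rw [volume_fundamentalDomain_latticeBasis]
    refine (mul_le_of_le_one_left (zero_le) (pow_le_one₀ (zero_le) (by simp))).trans ?_
    rw [ENNReal.ofReal]
    apply le_of_eq
    congr 1
    apply NNReal.eq
    rw [Real.coe_sqrt, Real.coe_toNNReal _ (Real.sqrt_nonneg _)]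
    simp [Int.norm_eq_abs]
  obtain ⟨⟨x, hx⟩, h_nz, h_mem⟩ := exists_ne_zero_mem_lattice_of_measure_mul_two_pow_lt_measure
    h_fund hs_neg hs_conv (by
      refine lt_of_lt_of_le ?_ (measure_mono hsub)
      rw [hvol, mixedEmbedding.finrank]
      refine lt_of_le_of_lt (mul_le_mul_left hle _) ?_
      rw [show (2 : ENNReal) = ENNReal.ofReal 2 by simp, ← ENNReal.ofReal_pow (by norm_num),
        ← ENNReal.ofReal_mul (by positivity)]
      exact (ENNReal.ofReal_lt_ofReal_iff (Finset.prod_pos fun i _ => hB i)).2 (by linarith))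
  rw [Submodule.mem_toAddSubgroup, mem_span_latticeBasis] at hx
  obtain ⟨y, rfl⟩ := hx
  refine ⟨y, y.isIntegral_coe, ?_, h_mem⟩
  rintro h0
  apply h_nz
  ext1
  simpa using h0

open scoped Classical in
theorem house_le_two_mul_norm_realCoord {K : Type*} [Field K] [NumberField K] (x : K) :
    house x ≤ 2 * ‖realCoord K x‖ := by
  have hc (i : index K) : |(stdBasis K).repr (mixedEmbedding K x) i| ≤ ‖realCoord K x‖ :=
    norm_le_pi_norm (realCoord K x) i
  rw [house, canonicalEmbedding.norm_le_iff]
  intro φ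
  rw [← InfinitePlace.apply φ, ← InfinitePlace.norm_embedding_eq]
  rcases InfinitePlace.isReal_or_isComplex (InfinitePlace.mk φ) with h | h
  · rw [InfinitePlace.norm_embedding_eq, ← InfinitePlace.norm_embedding_of_isReal h]
    have := hc (Sum.inl ⟨_, h⟩)
    rw [stdBasis_apply_isReal, mixedEmbedding_apply_isReal] at this
    have h0 := norm_nonneg (realCoord K x)
    linarith [Real.norm_eq_abs (InfinitePlace.embedding_of_isReal h x)]
  · have h1 := hc (Sum.inr (⟨_, h⟩, 0))
    have h2 := hc (Sum.inr (⟨_, h⟩, 1))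
    rw [stdBasis_apply_isComplex_fst, mixedEmbedding_apply_isComplex] at h1
    rw [stdBasis_apply_isComplex_snd, mixedEmbedding_apply_isComplex] at h2
    have := Complex.norm_le_abs_re_add_abs_im ((InfinitePlace.mk φ).embedding x)
    linarith

/-- The constant in the bound for half of the successive minima of a ring of integers. -/
noncomputable def minimaConst (n : ℕ) : ℝ := 2 ^ (n + 1) * (4 * 7 ^ n) ^ n

theorem one_le_minimaConst (n : ℕ) : 1 ≤ minimaConst n := by
  have h1 : (1 : ℝ) ≤ 2 ^ (n + 1) := one_le_pow₀ (by norm_num)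
  have h2 : (1 : ℝ) ≤ 7 ^ n := one_le_pow₀ (by norm_num)
  have h3 : (1 : ℝ) ≤ (4 * 7 ^ n) ^ n := one_le_pow₀ (by linarith)
  exact one_le_mul_of_one_le_of_one_le h1 h3

theorem one_le_abs_discr (K : Type*) [Field K] [NumberField K] : (1 : ℝ) ≤ |(discr K : ℝ)| := by
  exact_mod_cast Int.one_le_abs (discr_ne_zero K)

theorem lt_prod_of_box {n m : ℕ} (hm : 2 * m ≤ n) (hn : 0 < n) {D : ℝ} (hD : 1 ≤ D) :
    2 ^ n * √D < (1 / (4 * 7 ^ m)) ^ m * (minimaConst n * D ^ (1 / (n : ℝ))) ^ (n - m) := by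
  have hn' : (0 : ℝ) < n := by exact_mod_cast hn
  have h1 : √D ≤ (D ^ (1 / (n : ℝ))) ^ (n - m) := by
    rw [Real.sqrt_eq_rpow, ← Real.rpow_natCast, ← Real.rpow_mul (by linarith)]
    apply Real.rpow_le_rpow_of_exponent_le hD
    rw [Nat.cast_sub (by omega), one_div_mul_eq_div, div_le_div_iff₀ (by norm_num) hn']
    have : (2 : ℝ) * m ≤ n := by exact_mod_cast hm
    linarith
  have h2 : minimaConst n ≤ minimaConst n ^ (n - m) :=
    le_self_pow₀ (one_le_minimaConst n) (by omega)
  have h3 : (4 * (7 : ℝ) ^ m) ^ m ≤ (4 * 7 ^ n) ^ n := by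
    have h7 : (7 : ℝ) ^ m ≤ 7 ^ n := pow_le_pow_right₀ (by norm_num) (by omega)
    have h7' : (1 : ℝ) ≤ 7 ^ n := one_le_pow₀ (by norm_num)
    calc (4 * (7 : ℝ) ^ m) ^ m ≤ (4 * 7 ^ n) ^ m := by gcongr
      _ ≤ _ := pow_le_pow_right₀ (by linarith) (by omega)
  have h4 : (2 : ℝ) ^ n < (1 / (4 * 7 ^ m)) ^ m * minimaConst n := by
    rw [one_div, inv_pow, ← div_eq_inv_mul, lt_div_iff₀ (by positivity), minimaConst, pow_succ]
    have : (0 : ℝ) < (4 * 7 ^ m) ^ m := by positivity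
    have h5 : (0 : ℝ) < 2 ^ n := by positivity
    nlinarith [mul_le_mul_of_nonneg_left h3 h5.le, mul_pos h5 this]
  have hs : 0 < √D := Real.sqrt_pos.2 (by linarith)
  rw [mul_pow, ← mul_assoc]
  calc 2 ^ n * √D < ((1 / (4 * 7 ^ m)) ^ m * minimaConst n) * √D := by gcongr
    _ ≤ _ := by
      have := one_le_minimaConst n
      gcongr

/-- If `u` is controlled by its coordinates in `P`, and `v` is small on `P` with largest
coordinate at `w`, then `u + a • v` is controlled by its coordinates in `insert w P`. -/
theorem norm_add_smul_le_of_pivot {ι : Type*} [Fintype ι] [DecidableEq ι] {P : Finset ι} {w : ι}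
    {u v : ι → ℝ} {a A ε t : ℝ} (hA1 : 1 ≤ A) (hAε : A * ε = 1 / 4) (hvP : ∀ i ∈ P, |v i| ≤ ε)
    (hw : |v w| = ‖v‖) (hv : 1 / 2 ≤ ‖v‖) (ht : 0 ≤ t)
    (h : ∀ i ∈ insert w P, |(u + a • v) i| ≤ t)
    (hu : ∀ s : ℝ, 0 ≤ s → (∀ i ∈ P, |u i| ≤ s) → ‖u‖ ≤ A * s) :
    ‖u + a • v‖ ≤ 7 * A * t := by
  have hε0 : 0 < ε := by
    by_contra! h
    nlinarith
  have ha0 := abs_nonneg a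
  simp only [Pi.add_apply, Pi.smul_apply, smul_eq_mul] at h
  have hu' := hu (t + |a| * ε) (by positivity) fun i hi => by
    have h1 := abs_sub (u i + a * v i) (a * v i)
    rw [add_sub_cancel_right, abs_mul] at h1
    have h2 : |a| * |v i| ≤ |a| * ε := by
      gcongr
      exact hvP i hi
    linarith [h i (Finset.mem_insert_of_mem hi)]
  have hav : |a| * ‖v‖ ≤ t + ‖u‖ := by
    have h2 := norm_le_pi_norm u w
    rw [Real.norm_eq_abs] at h2
    rw [← hw, ← abs_mul]
    have := abs_sub (u w + a * v w) (u w)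
    rw [add_sub_cancel_left] at this
    linarith [h w (Finset.mem_insert_self _ _)]
  have hsum : ‖u + a • v‖ ≤ ‖u‖ + |a| * ‖v‖ := by
    rw [← Real.norm_eq_abs, ← _root_.norm_smul]
    exact norm_add_le _ _
  have h4 : |a| * (1 / 2) ≤ |a| * ‖v‖ := by gcongr
  have h5 : A * (t + |a| * ε) = A * t + |a| / 4 := by
    linear_combination |a| * hAε
  have h6 : t ≤ A * t := le_mul_of_one_le_left ht hA1
  linarith

open scoped Classical in
/-- One can find independent small integers, in number at most half the degree plus one, which
are controlled by as many of their real coordinates. -/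
theorem exists_submodule_small {K : Type*} [Field K] [NumberField K] (m : ℕ)
    (hm : 2 * m ≤ finrank ℚ K + 2) (hm' : m ≤ finrank ℚ K) :
    ∃ S : Set K, (∀ x ∈ S, IsIntegral ℤ x ∧ ‖realCoord K x‖ ≤
        minimaConst (finrank ℚ K) * |(discr K : ℝ)| ^ (1 / (finrank ℚ K : ℝ))) ∧
      finrank ℚ (Submodule.span ℚ S) = m ∧
      ∃ P : Finset (index K), P.card = m ∧ ∀ v ∈ Submodule.span ℚ S, ∀ t : ℝ, 0 ≤ t →
        (∀ i ∈ P, |realCoord K v i| ≤ t) → ‖realCoord K v‖ ≤ 7 ^ m * t := by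
  induction m with
  | zero =>
    refine ⟨∅, by simp, by simp, ∅, by simp, ?_⟩
    intro v hv t ht _
    rw [Submodule.span_empty, Submodule.mem_bot] at hv
    simpa [hv] using ht
  | succ m ih =>
    obtain ⟨S, hS, hfin, P, hP, hV⟩ := ih (by omega) (by omega)
    set n := finrank ℚ K with hn
    have hD := one_le_abs_discr K
    set b := minimaConst n * |(discr K : ℝ)| ^ (1 / (n : ℝ)) with hb
    have hb1 : 1 ≤ b := one_le_mul_of_one_le_of_one_le (one_le_minimaConst n)
      (Real.one_le_rpow hD (by positivity))
    set A : ℝ := 7 ^ m with hA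
    have hA1 : 1 ≤ A := one_le_pow₀ (by norm_num)
    set ε : ℝ := 1 / (4 * A) with hε
    have hε0 : 0 < ε := by positivity
    have hAε : A * ε = 1 / 4 := by rw [hε]; field_simp
    have hε4 : ε ≤ 1 / 4 := by nlinarith
    obtain ⟨x, hxi, hx0, hx⟩ := exists_ne_zero_abs_realCoord_lt (K := K)
      (fun i => if i ∈ P then ε else b) (fun i => by split_ifs <;> linarith) (by
        rw [Finset.prod_ite, Finset.prod_const, Finset.prod_const, Finset.filter_mem_eq_inter,
          Finset.univ_inter, hP, ← Finset.sdiff_eq_filter, Finset.card_univ_sdiff, card_index, hP]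
        exact lt_prod_of_box (by omega) (by omega) hD)
    have hxb : ‖realCoord K x‖ ≤ b := by
      rw [pi_norm_le_iff_of_nonneg (by linarith)]
      intro i
      have := hx i
      rw [Real.norm_eq_abs]
      split_ifs at this <;> linarith
    have hd : 1 / 2 ≤ ‖realCoord K x‖ := by
      linarith [one_le_house_of_isIntegral hxi hx0, house_le_two_mul_norm_realCoord x]
    have hne : Nonempty (index K) := by
      rw [← Fintype.card_pos_iff, card_index]
      exact finrank_pos
    obtain ⟨w, hw⟩ : ∃ w, |realCoord K x w| = ‖realCoord K x‖ := by
      obtain ⟨w, hw⟩ := Finite.exists_max fun i => |realCoord K x i|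
      refine ⟨w, le_antisymm (norm_le_pi_norm (realCoord K x) w) ?_⟩
      exact (pi_norm_le_iff_of_nonneg (abs_nonneg _)).2 hw
    have hxP : ∀ i ∈ P, |realCoord K x i| ≤ ε := fun i hi => by
      have := hx i
      rw [if_pos hi] at this
      exact this.le
    have hwP : w ∉ P := fun hwP => by linarith [hxP w hwP]
    have hxV : x ∉ Submodule.span ℚ S := fun hxV => by
      have := hV x hxV ε hε0.le hxP
      linarith
    have hspan : Submodule.span ℚ (insert x S) = Submodule.span ℚ S ⊔ Submodule.span ℚ {x} := by
      rw [Submodule.span_insert, sup_comm]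
    refine ⟨insert x S, ?_, ?_, insert w P, ?_, ?_⟩
    · rintro y (rfl | hy)
      exacts [⟨hxi, hxb⟩, hS y hy]
    · rw [hspan, Submodule.finrank_sup_span_singleton hxV, hfin]
    · rw [Finset.card_insert_of_notMem hwP, hP]
    · intro y hy t ht hyt
      rw [hspan] at hy
      obtain ⟨v, hv, z, hz, rfl⟩ := Submodule.mem_sup.1 hy
      obtain ⟨a, rfl⟩ := Submodule.mem_span_singleton.1 hz
      have hmap : realCoord K (v + a • x) = realCoord K v + (a : ℝ) • realCoord K x := by
        ext i
        rw [map_add, map_smul, Pi.add_apply, Pi.smul_apply, Rat.smul_def, Pi.add_apply,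
          Pi.smul_apply, smul_eq_mul]
      rw [hmap] at hyt ⊢
      rw [pow_succ, mul_comm _ (7 : ℝ)]
      exact norm_add_smul_le_of_pivot hA1 hAε hxP hw hd ht hyt (hV v hv)

/-- A subspace of dimension more than half the degree spans the field multiplicatively. -/
theorem Submodule.mul_self_eq_top_of_lt_two_mul_finrank {F K : Type*} [Field F] [Field K]
    [Algebra F K] [FiniteDimensional F K] (V : Submodule F K)
    (hV : finrank F K < 2 * finrank F V) : V * V = ⊤ := by
  by_contra hne
  obtain ⟨f, hf0, hf⟩ := Submodule.exists_le_ker_of_lt_top _ (lt_top_iff_ne_top.2 hne)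
  let B : LinearMap.BilinForm F K := (LinearMap.mul F K).compr₂ f
  have hB (x y) : B x y = f (x * y) := rfl
  have hsymm : B.IsSymm := ⟨fun x y => by simp [hB, mul_comm]⟩
  have hnd : B.Nondegenerate := by
    refine (LinearMap.IsRefl.nondegenerate_iff_separatingLeft hsymm.isRefl).2 fun x hx => ?_
    by_contra hx0
    apply hf0
    ext y
    have := hx (x⁻¹ * y)
    rwa [hB, mul_inv_cancel_left₀ hx0] at this
  have hle : V ≤ B.orthogonal V := by
    intro y hy x hx
    exact hf (Submodule.mul_mem_mul hx hy)
  have h1 := Submodule.finrank_mono hle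
  rw [LinearMap.BilinForm.finrank_orthogonal hnd] at h1
  have := Submodule.finrank_le V
  omega

/-- The constant in the bound for the integral elements of a `ℚ`-basis of a number field. -/
noncomputable def basisConst (n : ℕ) : ℝ := (2 * minimaConst n) ^ 2

open scoped Pointwise in
/-- A number field of degree `n` and discriminant `D` has a basis of integers whose conjugates are
bounded by a multiple of `|D| ^ (2 / n)`. -/
theorem exists_basis_house_le {K : Type*} [Field K] [NumberField K] {n : ℕ}
    (hn : finrank ℚ K = n) :
    ∃ ω : Basis (Fin n) ℚ K, ∀ i, IsIntegral ℤ (ω i) ∧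
      house (ω i) ≤ basisConst n * |(discr K : ℝ)| ^ (2 / (n : ℝ)) := by
  have hpos : 0 < finrank ℚ K := finrank_pos
  obtain ⟨S, hS, hfin, -⟩ := exists_submodule_small (K := K) (finrank ℚ K / 2 + 1)
    (by omega) (by omega)
  rw [hn] at hS hpos
  have htop : Submodule.span ℚ (S * S) = ⊤ := by
    rw [← Submodule.span_mul_span]
    exact Submodule.mul_self_eq_top_of_lt_two_mul_finrank _ (by rw [hfin]; omega)
  obtain ⟨T, hTS, hT, hli⟩ := exists_linearIndependent ℚ (S * S)
  let ω : Basis T ℚ K := Basis.mk hli (by rw [Subtype.range_coe, hT, htop])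
  have : Fintype T := FiniteDimensional.fintypeBasisIndex ω
  have hcard : Fintype.card T = n := by rw [← hn, finrank_eq_card_basis ω]
  refine ⟨ω.reindex (Fintype.equivFinOfCardEq hcard), fun i => ?_⟩
  rw [Basis.reindex_apply, Basis.mk_apply]
  obtain ⟨x, hx, y, hy, hxy⟩ := hTS ((Fintype.equivFinOfCardEq hcard).symm i).2
  change x * y = _ at hxy
  rw [← hxy]
  refine ⟨(hS x hx).1.mul (hS y hy).1, (house_mul_le x y).trans ?_⟩
  have hx' := (house_le_two_mul_norm_realCoord x).trans
    (mul_le_mul_of_nonneg_left (hS x hx).2 zero_le_two)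
  have hy' := (house_le_two_mul_norm_realCoord y).trans
    (mul_le_mul_of_nonneg_left (hS y hy).2 zero_le_two)
  refine (mul_le_mul hx' hy' (house_nonneg y) ((house_nonneg x).trans hx')).trans (le_of_eq ?_)
  have : |(discr K : ℝ)| ^ (2 / (n : ℝ)) = (|(discr K : ℝ)| ^ (1 / (n : ℝ))) ^ 2 := by
    rw [← Real.rpow_natCast, ← Real.rpow_mul (abs_nonneg _)]
    congr 1
    push_cast
    ring
  rw [this, basisConst]
  ring

theorem basis_induction {R M ι : Type*} [Semiring R] [AddCommMonoid M] [Module R M]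
    (b : Basis ι R M) {p : M → Prop} (x : M) (zero : p 0)
    (add : ∀ x y, p x → p y → p (x + y)) (smul : ∀ (a : R) x, p x → p (a • x))
    (basis : ∀ i, p (b i)) : p x :=
  Submodule.span_induction (p := fun x _ => p x) (by rintro _ ⟨i, rfl⟩; exact basis i) zero
    (fun x y _ _ => add x y) (fun a x _ => smul a x) (b.mem_span x)

/-- Two number fields generated by tuples `α`, `β` are isomorphic as soon as the traces of the
monomials `m i * m l` and `α j * m i * m l` match, where the `m i` form a basis containing `1`. -/
theorem nonempty_ringEquiv_of_trace_eq {K L ι κ : Type*} [Field K] [NumberField K] [Field L]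
    [NumberField L] [Finite ι] (α : κ → K) (β : κ → L) (b : Basis ι ℚ K) (c : Basis ι ℚ L)
    (i₀ : ι) (hb : b i₀ = 1) (hc : c i₀ = 1)
    (hbα : ∀ i, b i ∈ (MvPolynomial.aeval (R := ℚ) α).range)
    (h₁ : ∀ i l, Algebra.trace ℚ K (b i * b l) = Algebra.trace ℚ L (c i * c l))
    (h₂ : ∀ j i l, Algebra.trace ℚ K (α j * b i * b l) = Algebra.trace ℚ L (β j * c i * c l)) :
    Nonempty (K ≃+* L) := by
  let φ : K ≃ₗ[ℚ] L := b.equiv c (Equiv.refl ι)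
  have hφ (i) : φ (b i) = c i := by simp [φ]
  have htr (x : K) (l : ι) : Algebra.trace ℚ L (φ x * c l) = Algebra.trace ℚ K (x * b l) := by
    induction x using basis_induction b with
    | zero => simp
    | add x y hx hy => simp only [map_add, add_mul, hx, hy]
    | smul a x hx => simp only [map_smul, smul_mul_assoc, hx]
    | basis i => rw [hφ, h₁]
  have hext (y z : L) (h : ∀ l, Algebra.trace ℚ L (y * c l) = Algebra.trace ℚ L (z * c l)) :
      y = z := by
    rw [← sub_eq_zero]
    refine (traceForm_nondegenerate ℚ L).1 _ fun w => ?_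
    induction w using basis_induction c with
    | zero => simp
    | add x y hx hy => rw [map_add, hx, hy, add_zero]
    | smul a x hx => rw [map_smul, hx, smul_zero]
    | basis l => rw [Algebra.traceForm_apply, sub_mul, map_sub, h, sub_self]
  have hmul (j : κ) (x : K) : φ (α j * x) = β j * φ x := by
    induction x using basis_induction b with
    | zero => simp
    | add x y hx hy => simp only [map_add, mul_add, hx, hy]
    | smul a x hx => simp only [map_smul, mul_smul_comm, hx]
    | basis i =>
      refine hext _ _ fun l => ?_
      rw [htr, hφ, h₂]
  have hone : φ 1 = 1 := by rw [← hb, hφ, hc]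
  have haeval (p : MvPolynomial κ ℚ) :
      φ (MvPolynomial.aeval α p) = MvPolynomial.aeval β p := by
    induction p using MvPolynomial.induction_on with
    | C a =>
      rw [MvPolynomial.aeval_C, MvPolynomial.aeval_C, Algebra.algebraMap_eq_smul_one, map_smul,
        hone, Algebra.algebraMap_eq_smul_one]
    | add p q hp hq => simp only [map_add, hp, hq]
    | mul_X p j hp =>
      simp only [map_mul, MvPolynomial.aeval_X]
      rw [mul_comm, hmul, hp, mul_comm]
  have hsurj (x : K) : x ∈ (MvPolynomial.aeval (R := ℚ) α).range := by
    induction x using basis_induction b with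
    | zero => exact zero_mem _
    | add x y hx hy => exact add_mem hx hy
    | smul a x hx => exact Subalgebra.smul_mem _ hx a
    | basis i => exact hbα i
  refine ⟨{ φ with map_mul' := fun x y => ?_ }⟩
  obtain ⟨p, rfl⟩ := hsurj x
  obtain ⟨q, rfl⟩ := hsurj y
  change φ (MvPolynomial.aeval α p * MvPolynomial.aeval α q) =
    φ (MvPolynomial.aeval α p) * φ (MvPolynomial.aeval α q)
  rw [← map_mul, haeval, haeval, haeval, map_mul]

/-- The base-`s` digits of `i`, as a tuple of exponents. -/
def digitExp {n r s : ℕ} (h : n ≤ s ^ r) (i : Fin n) : Fin r → Fin s :=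
  finFunctionFinEquiv.symm (Fin.castLE h i)

theorem sum_digitExp {n r s : ℕ} (h : n ≤ s ^ r) (i : Fin n) :
    ∑ j, (digitExp h i j : ℕ) * s ^ (j : ℕ) = i := by
  rw [← finFunctionFinEquiv_apply, digitExp, Equiv.apply_symm_apply, Fin.val_castLE]

/-- The determinant of the monomials with exponents `digitExp h i` evaluated at the conjugates of
generic linear combinations of the elements `ω l`. -/
noncomputable def monomialDet {K : Type*} [Field K] [NumberField K] {n r s : ℕ} (h : n ≤ s ^ r)
    (e : Fin n ≃ (K →ₐ[ℚ] ℂ)) (ω : Fin n → K) : MvPolynomial (Fin r × Fin n) ℂ :=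
  Matrix.det (Matrix.of fun i k => ∏ j : Fin r,
    (∑ l, MvPolynomial.C (e k (ω l)) * MvPolynomial.X (j, l)) ^ (digitExp h i j : ℕ))

theorem totalDegree_monomialDet_le {K : Type*} [Field K] [NumberField K] {n r s : ℕ}
    (h : n ≤ s ^ r) (e : Fin n ≃ (K →ₐ[ℚ] ℂ)) (ω : Fin n → K) :
    (monomialDet h e ω).totalDegree ≤ n * (r * s) := by
  rw [monomialDet, Matrix.det_apply]
  refine MvPolynomial.totalDegree_finsetSum_le fun σ _ => ?_
  refine (MvPolynomial.totalDegree_smul_le _ _).trans ?_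
  refine (MvPolynomial.totalDegree_finsetProd _ _).trans ?_
  refine (Finset.sum_le_card_nsmul _ _ (r * s) fun k _ => ?_).trans (by simp)
  rw [Matrix.of_apply]
  refine (MvPolynomial.totalDegree_finsetProd _ _).trans ?_
  refine (Finset.sum_le_card_nsmul _ _ s fun j _ => ?_).trans (by simp)
  refine (MvPolynomial.totalDegree_pow _ _).trans ?_
  refine (Nat.mul_le_mul (digitExp h (σ k) j).2.le
    (MvPolynomial.totalDegree_finsetSum_le (d := 1) fun l _ => ?_)).trans (by simp)
  refine (MvPolynomial.totalDegree_mul _ _).trans ?_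
  simp

theorem eval_monomialDet {K : Type*} [Field K] [NumberField K] {n r s : ℕ} (h : n ≤ s ^ r)
    (e : Fin n ≃ (K →ₐ[ℚ] ℂ)) (ω : Fin n → K) (q : Fin r → Fin n → ℚ) :
    MvPolynomial.eval (fun p => (q p.1 p.2 : ℂ)) (monomialDet h e ω) =
      (Algebra.embeddingsMatrixReindex ℚ ℂ
        (fun i => ∏ j, (∑ l, q j l • ω l) ^ (digitExp h i j : ℕ)) e).det := by
  rw [monomialDet, RingHom.map_det]
  congr 1
  ext i k
  simp only [Algebra.embeddingsMatrixReindex, Matrix.reindex_apply, Matrix.submatrix_apply,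
    Algebra.embeddingsMatrix_apply, RingHom.mapMatrix_apply, Matrix.map_apply, Matrix.of_apply,
    map_prod, map_pow, map_sum, map_mul, MvPolynomial.eval_C, MvPolynomial.eval_X]
  simp [Rat.smul_def, mul_comm]

theorem monomialDet_ne_zero {K : Type*} [Field K] [NumberField K] {n r s : ℕ} (h : n ≤ s ^ r)
    (e : Fin n ≃ (K →ₐ[ℚ] ℂ)) (ω : Basis (Fin n) ℚ K) : monomialDet h e ω ≠ 0 := by
  intro h0
  let pb := Field.powerBasisOfFiniteOfSeparable ℚ K
  have hdim : pb.dim = n := by rw [← pb.finrank, finrank_eq_card_basis ω, Fintype.card_fin]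
  let b : Basis (Fin n) ℚ K := pb.basis.reindex (finCongr hdim)
  have hb (i : Fin n) : b i = pb.gen ^ (i : ℕ) := by simp [b]
  have heval := eval_monomialDet h e ω (fun j l => ω.repr (pb.gen ^ s ^ (j : ℕ)) l)
  have hfun : (fun i => ∏ j : Fin r, (∑ l, ω.repr (pb.gen ^ s ^ (j : ℕ)) l • ω l) ^
      (digitExp h i j : ℕ)) = b := by
    ext i
    simp_rw [ω.sum_repr, ← pow_mul]
    rw [Finset.prod_pow_eq_pow_sum, hb, ← sum_digitExp h i]
    simp_rw [mul_comm]
  rw [hfun, h0, map_zero] at heval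
  have := Algebra.discr_eq_det_embeddingsMatrixReindex_pow_two ℚ ℂ b e
  rw [← heval, zero_pow two_ne_zero, map_eq_zero] at this
  exact Algebra.discr_not_zero_of_basis ℚ b this

/-- Some small combinations of the elements of a basis have linearly independent monomials. -/
theorem exists_linearIndependent_monomials {K : Type*} [Field K] [NumberField K] {n r s : ℕ}
    (h : n ≤ s ^ r) (ω : Basis (Fin n) ℚ K) :
    ∃ c : Fin r → Fin n → ℕ, (∀ j l, c j l ≤ n * (r * s)) ∧
      LinearIndependent ℚ
        (fun i => ∏ j, (∑ l, (c j l : ℚ) • ω l) ^ (digitExp h i j : ℕ)) := by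
  have hcard : Fintype.card (K →ₐ[ℚ] ℂ) = n := by
    rw [AlgHom.card, finrank_eq_card_basis ω, Fintype.card_fin]
  let e : Fin n ≃ (K →ₐ[ℚ] ℂ) := (Fintype.equivFinOfCardEq hcard).symm
  by_contra! hc
  refine monomialDet_ne_zero h e ω (MvPolynomial.eq_zero_of_eval_zero_at_prod_finset _
    (fun _ => (Finset.range (n * (r * s) + 1)).image Nat.cast) (fun p => ?_) fun x hx => ?_)
  · rw [Finset.card_image_of_injective _ Nat.cast_injective, Finset.card_range, Nat.lt_succ_iff]
    exact (MvPolynomial.degreeOf_le_totalDegree _ _).trans (totalDegree_monomialDet_le h e ω)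
  · simp only [Finset.mem_image, Finset.mem_range, Nat.lt_succ_iff] at hx
    choose c hc' hcx using hx
    have hli := hc (fun j l => c (j, l)) fun j l => hc' (j, l)
    have hdisc := Algebra.discr_eq_det_embeddingsMatrixReindex_pow_two ℚ ℂ
      (fun i => ∏ j, (∑ l, ((fun j l => (c (j, l) : ℚ)) j l) • ω l) ^ (digitExp h i j : ℕ)) e
    rw [← eval_monomialDet, Algebra.discr_zero_of_not_linearIndependent ℚ hli, map_zero, eq_comm,
      sq_eq_zero_iff] at hdisc
    rw [← hdisc]
    congr 2
    ext p
    simp [hcx]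

/-- The constant in the bound for a tuple of integers whose monomials generate a number field. -/
noncomputable def tupleConst (n r s : ℕ) : ℝ := 1 + n * (n * (r * s)) * basisConst n

theorem basisConst_nonneg (n : ℕ) : 0 ≤ basisConst n := sq_nonneg _

theorem one_le_tupleConst (n r s : ℕ) : 1 ≤ tupleConst n r s := by
  have := basisConst_nonneg n
  rw [tupleConst, le_add_iff_nonneg_right]
  positivity

theorem exists_tuple_house_le {K : Type*} [Field K] [NumberField K] {n r s : ℕ}
    (hn : finrank ℚ K = n) (h : n ≤ s ^ r) :
    ∃ α : Fin r → 𝓞 K,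
      (∀ j, house (α j : K) ≤ tupleConst n r s * |(discr K : ℝ)| ^ (2 / (n : ℝ))) ∧
      LinearIndependent ℚ (fun i => ∏ j, (α j : K) ^ (digitExp h i j : ℕ)) := by
  obtain ⟨ω, hω⟩ := exists_basis_house_le hn
  obtain ⟨c, hc, hli⟩ := exists_linearIndependent_monomials h ω
  have hsmul (j) : ∑ l, (c j l : ℚ) • ω l = ∑ l, (c j l : K) * ω l := by
    simp [Algebra.smul_def]
  have hint (j) : IsIntegral ℤ (∑ l, (c j l : ℚ) • ω l) := by
    rw [hsmul]
    exact IsIntegral.sum _ fun l _ => (isIntegral_natCast _).mul (hω l).1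
  refine ⟨fun j => ⟨_, hint j⟩, fun j => ?_, hli⟩
  change house (∑ l, (c j l : ℚ) • ω l) ≤ _
  rw [hsmul]
  have hD : 0 ≤ |(discr K : ℝ)| ^ (2 / (n : ℝ)) := by positivity
  have hbound : ∀ l ∈ Finset.univ, house ((c j l : K) * ω l) ≤
      (n * (r * s) : ℝ) * (basisConst n * |(discr K : ℝ)| ^ (2 / (n : ℝ))) := fun l _ => by
    rw [house_nat_mul]
    exact mul_le_mul (by exact_mod_cast hc j l) (hω l).2 (house_nonneg _) (by positivity)
  refine (house_sum_le_sum_house _ _).trans ((Finset.sum_le_card_nsmul _ _ _ hbound).trans ?_)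
  rw [Finset.card_univ, Fintype.card_fin, nsmul_eq_mul, tupleConst, add_mul]
  nlinarith

/-- The traces of the monomials of multidegree less than `t` in a tuple of integers. -/
noncomputable def traceTable {K : Type*} [Field K] [NumberField K] {r t : ℕ} (α : Fin r → 𝓞 K)
    (d : Fin r → Fin t) : ℤ :=
  Algebra.trace ℤ (𝓞 K) (∏ j, α j ^ (d j : ℕ))

theorem traceTable_cast {K : Type*} [Field K] [NumberField K] {r t : ℕ} (α : Fin r → 𝓞 K)
    (d : Fin r → Fin t) :
    (traceTable α d : ℚ) = Algebra.trace ℚ K (∏ j, (α j : K) ^ (d j : ℕ)) := by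
  rw [traceTable, Algebra.coe_trace_int]
  congr 1
  push_cast
  rfl

theorem abs_traceTable_le {K : Type*} [Field K] [NumberField K] {r t : ℕ} (α : Fin r → 𝓞 K)
    {A : ℝ} (hA : 1 ≤ A) (hα : ∀ j, house (α j : K) ≤ A) (d : Fin r → Fin t) :
    |(traceTable α d : ℝ)| ≤ finrank ℚ K * A ^ (t * r) := by
  have htr := trace_eq_sum_embeddings (K := ℚ) ℂ (x := ∏ j, (α j : K) ^ (d j : ℕ))
  rw [← traceTable_cast, eq_ratCast, Rat.cast_intCast] at htr
  rw [← Complex.norm_intCast, htr]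
  refine (norm_sum_le_of_le (f := fun σ : K →ₐ[ℚ] ℂ => σ (∏ j, (α j : K) ^ (d j : ℕ)))
    Finset.univ (n := fun _ => A ^ (t * r)) fun σ _ => ?_).trans ?_
  · rw [map_prod, norm_prod, pow_mul]
    refine (Finset.prod_le_prod (fun _ _ => norm_nonneg _) (g := fun _ => A ^ t)
      fun j _ => ?_).trans (by simp)
    rw [map_pow, norm_pow]
    calc ‖σ (α j)‖ ^ (d j : ℕ) ≤ A ^ (d j : ℕ) := by
          gcongr
          exact (norm_embedding_le_house (α j : K) σ.toRingHom).trans (hα j)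
      _ ≤ A ^ t := pow_le_pow_right₀ hA (d j).2.le
  · rw [Finset.sum_const, Finset.card_univ, AlgHom.card, nsmul_eq_mul]

theorem digitExp_zero {n r s : ℕ} (h : n ≤ s ^ r) (hn : 0 < n) (j : Fin r) :
    (digitExp h ⟨0, hn⟩ j : ℕ) = 0 := by
  have hs := sum_digitExp h ⟨0, hn⟩
  rw [Finset.sum_eq_zero_iff] at hs
  have := hs j (Finset.mem_univ j)
  have hspos : 0 < s := (Nat.zero_le _).trans_lt (digitExp h ⟨0, hn⟩ j).2
  exact (Nat.mul_eq_zero.1 this).resolve_right (pow_pos hspos _).ne'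

theorem mul_prod_pow_mul_prod_pow {M : Type*} [CommMonoid M] {r : ℕ} (x : Fin r → M) (j : Fin r)
    (a b : Fin r → ℕ) :
    x j * (∏ k, x k ^ a k) * ∏ k, x k ^ b k =
      ∏ k, x k ^ ((Pi.single j 1 : Fin r → ℕ) k + a k + b k) := by
  simp only [pow_add, Finset.prod_mul_distrib]
  congr 2
  rw [Finset.prod_eq_single j (fun k _ hk => by simp [hk]) (by simp)]
  simp

theorem nonempty_ringEquiv_of_traceTable_eq {K L : Type*} [Field K] [NumberField K] [Field L]
    [NumberField L] {n r s : ℕ} (hK : finrank ℚ K = n) (hL : finrank ℚ L = n) (h : n ≤ s ^ r)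
    (α : Fin r → 𝓞 K) (β : Fin r → 𝓞 L)
    (hα : LinearIndependent ℚ (fun i => ∏ j, (α j : K) ^ (digitExp h i j : ℕ)))
    (hβ : LinearIndependent ℚ (fun i => ∏ j, (β j : L) ^ (digitExp h i j : ℕ)))
    (htab : (traceTable α : (Fin r → Fin (2 * s)) → ℤ) = traceTable β) :
    Nonempty (K ≃+* L) := by
  have hn : 0 < n := hK ▸ finrank_pos
  have : Nonempty (Fin n) := ⟨⟨0, hn⟩⟩
  have htr (d : Fin r → ℕ) (hd : ∀ j, d j < 2 * s) :
      Algebra.trace ℚ K (∏ j, (α j : K) ^ d j) = Algebra.trace ℚ L (∏ j, (β j : L) ^ d j) := by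
    have := congrArg (Int.cast : ℤ → ℚ) (congrFun htab fun j => ⟨d j, hd j⟩)
    rwa [traceTable_cast, traceTable_cast] at this
  refine nonempty_ringEquiv_of_trace_eq (fun j => (α j : K)) (fun j => (β j : L))
    (basisOfLinearIndependentOfCardEqFinrank hα (by simp [hK]))
    (basisOfLinearIndependentOfCardEqFinrank hβ (by simp [hL])) ⟨0, hn⟩ ?_ ?_ ?_ ?_ ?_ <;>
  simp only [coe_basisOfLinearIndependentOfCardEqFinrank]
  · simp [digitExp_zero h hn]
  · simp [digitExp_zero h hn]
  · intro i
    exact ⟨∏ j, MvPolynomial.X j ^ (digitExp h i j : ℕ), by simp⟩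
  · intro i l
    simp only [← Finset.prod_mul_distrib, ← pow_add]
    exact htr _ fun j => by omega
  · intro j i l
    have hK' := mul_prod_pow_mul_prod_pow (fun j => (α j : K)) j
      (fun k => (digitExp h i k : ℕ)) fun k => (digitExp h l k : ℕ)
    have hL' := mul_prod_pow_mul_prod_pow (fun j => (β j : L)) j
      (fun k => (digitExp h i k : ℕ)) fun k => (digitExp h l k : ℕ)
    rw [hK', hL']
    refine htr _ fun k => ?_
    have : (Pi.single j 1 : Fin r → ℕ) k ≤ 1 := by
      rw [Pi.single_apply]
      split_ifs <;> simp
    omega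

theorem countDegN_le {n r s : ℕ} (hn : 0 < n) (h : n ≤ s ^ r) {X : ℝ} (hX : 1 ≤ X) :
    (countDegN n X : ℝ) ≤ (3 * (n * (tupleConst n r s * X ^ (2 / (n : ℝ))) ^ (2 * s * r))) ^
      ((2 * s) ^ r) := by
  set A := tupleConst n r s * X ^ (2 / (n : ℝ)) with hA
  have hA1 : 1 ≤ A := one_le_mul_of_one_le_of_one_le (one_le_tupleConst n r s)
    (Real.one_le_rpow hX (by positivity))
  set R : ℝ := n * A ^ (2 * s * r) with hR
  have hR1 : 1 ≤ R := one_le_mul_of_one_le_of_one_le (by exact_mod_cast hn) (one_le_pow₀ hA1)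
  have hex : ∀ C : {C : Quotient (NFieldDeg.setoid n) //
      ∃ K : NFieldDeg n, ⟦K⟧ = C ∧ |(discr K.carrier : ℝ)| < X},
      ∃ (K : NFieldDeg n) (α : Fin r → 𝓞 K.carrier), ⟦K⟧ = C.1 ∧
        LinearIndependent ℚ (fun i => ∏ j, (α j : K.carrier) ^ (digitExp h i j : ℕ)) ∧
        ∀ d : Fin r → Fin (2 * s), traceTable α d ∈ Finset.Icc (-⌊R⌋) ⌊R⌋ := by
    rintro ⟨C, K, hKC, hKX⟩
    obtain ⟨α, hα, hli⟩ := exists_tuple_house_le K.deg h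
    refine ⟨K, α, hKC, hli, fun d => ?_⟩
    have hαA (j) : house (α j : K.carrier) ≤ A := (hα j).trans (by
      have := one_le_tupleConst n r s
      rw [hA]
      gcongr)
    have := abs_traceTable_le α hA1 hαA d
    rw [K.deg, ← hR, abs_le] at this
    rw [Finset.mem_Icc, neg_le, Int.le_floor, Int.le_floor]
    push_cast
    exact ⟨by linarith, this.2⟩
  choose K α hK hli htab using hex
  have hinj : Function.Injective fun C (d : Fin r → Fin (2 * s)) =>
      (⟨traceTable (α C) d, htab C d⟩ : Finset.Icc (-⌊R⌋) ⌊R⌋) := by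
    intro C C' hCC'
    apply Subtype.ext
    rw [← hK, ← hK]
    refine Quotient.sound (nonempty_ringEquiv_of_traceTable_eq (K C).deg (K C').deg h _ _
      (hli C) (hli C') (funext fun d => ?_))
    exact congrArg Subtype.val (congrFun hCC' d)
  have hcard := Nat.card_le_card_of_injective _ hinj
  rw [Nat.card_eq_fintype_card (α := (Fin r → Fin (2 * s)) → _), Fintype.card_fun,
    Fintype.card_fun, Fintype.card_coe, Int.card_Icc, Fintype.card_fin, Fintype.card_fin] at hcard
  calc (countDegN n X : ℝ) ≤ (((⌊R⌋ + 1 - -⌊R⌋).toNat ^ (2 * s) ^ r : ℕ) : ℝ) := by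
        rw [countDegN]
        exact_mod_cast hcard
    _ ≤ _ := by
      push_cast
      gcongr
      have h0 : 0 ≤ ⌊R⌋ := Int.floor_nonneg.2 (by linarith)
      have h1 : (((⌊R⌋ + 1 - -⌊R⌋).toNat : ℤ) : ℝ) = (⌊R⌋ + 1 - -⌊R⌋ : ℤ) := by
        rw [Int.toNat_of_nonneg (by omega)]
      rw [Int.cast_natCast] at h1
      rw [h1]
      push_cast
      linarith [Int.floor_le R]

/-- A choice of the number of generators and of the number of digits for which the exponent in
`countDegN_le` is at most `exp (15 * √(log n))`. -/
theorem exists_exponent_le {n : ℕ} (hn : 2 ≤ n) :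
    ∃ r s : ℕ, n ≤ s ^ r ∧
      2 / (n : ℝ) * (2 * s * r * (2 * s) ^ r) ≤ Real.exp (15 * √(Real.log n)) := by
  have hn0 : (0 : ℝ) < n := by exact_mod_cast (by omega : 0 < n)
  have hlog : Real.log 2 ≤ Real.log n := Real.log_le_log (by norm_num) (by exact_mod_cast hn)
  have hlog2 := Real.log_two_gt_d9
  set u := √(Real.log n) with hu
  have hu2 : u * u = Real.log n := Real.mul_self_sqrt (by linarith)
  have hu0 : 0 ≤ u := Real.sqrt_nonneg _
  have hu1 : 1 / 2 ≤ u := Real.le_sqrt_of_sq_le (by linarith)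
  have hexp : Real.exp (u * u) = n := by rw [hu2, Real.exp_log hn0]
  have hr := Nat.le_ceil u
  have hr' := (Nat.ceil_lt_add_one hu0).le
  have hs := Nat.le_ceil (Real.exp u)
  have hs' := (Nat.ceil_lt_add_one (Real.exp_pos u).le).le
  set r := ⌈u⌉₊
  set s := ⌈Real.exp u⌉₊
  have h1u : 1 ≤ Real.exp u := Real.one_le_exp hu0
  have h4 : (4 : ℝ) ≤ Real.exp 2 := by
    have := Real.exp_one_gt_d9
    rw [show (2 : ℝ) = 1 + 1 by norm_num, Real.exp_add]
    nlinarith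
  have h8 : (8 : ℝ) ≤ Real.exp 3 := by
    have := Real.exp_one_gt_d9
    rw [show (3 : ℝ) = 2 + 1 by norm_num, Real.exp_add]
    nlinarith
  refine ⟨r, s, ?_, ?_⟩
  · have : (n : ℝ) ≤ s ^ r := by
      calc (n : ℝ) = Real.exp (u * u) := hexp.symm
        _ ≤ Real.exp (r * u) := by gcongr
        _ = Real.exp u ^ r := Real.exp_nat_mul u r
        _ ≤ s ^ r := by gcongr
    exact_mod_cast this
  · have hbase : (2 * s : ℝ) ≤ Real.exp 2 * Real.exp u := by nlinarith
    have hpow : (2 * s : ℝ) ^ r ≤ n * Real.exp (3 * u + 2) := by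
      calc (2 * s : ℝ) ^ r ≤ (Real.exp 2 * Real.exp u) ^ r :=
            pow_le_pow_left₀ (by positivity) hbase r
        _ = Real.exp (r * (2 + u)) := by rw [← Real.exp_add, Real.exp_nat_mul]
        _ ≤ Real.exp ((u + 1) * (2 + u)) := by gcongr
        _ = n * Real.exp (3 * u + 2) := by
          rw [← hexp, ← Real.exp_add]
          ring_nf
    have hrexp : (r : ℝ) ≤ Real.exp u := hr'.trans (Real.add_one_le_exp u)
    have hsexp : (s : ℝ) ≤ 2 * Real.exp u := by linarith
    calc 2 / (n : ℝ) * (2 * s * r * (2 * s) ^ r)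
        ≤ 2 / (n : ℝ) * (2 * (2 * Real.exp u) * Real.exp u * (n * Real.exp (3 * u + 2))) := by
          gcongr
      _ = 8 * Real.exp (u + u + (3 * u + 2)) := by
          rw [Real.exp_add (u + u), Real.exp_add u u]
          field_simp
          ring
      _ ≤ Real.exp 3 * Real.exp (u + u + (3 * u + 2)) := by gcongr
      _ = Real.exp (5 * u + 5) := by
          rw [← Real.exp_add]
          ring_nf
      _ ≤ Real.exp (15 * u) := by
          gcongr
          linarith

end

/-- The Ellenberg-Venkatesh upper bound: there is a constant `C > 0` such that for
every `n ≥ 2`, `N_n(X) ≪_n X^{exp(C √(log n))}`. -/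
theorem ellenberg_venkatesh_bound :
    ∃ C : ℝ, 0 < C ∧ ∀ n : ℕ, 2 ≤ n → ∃ Cn : ℝ, ∀ X : ℝ, 2 ≤ X →
      (countDegN n X : ℝ) ≤ Cn * X ^ (Real.exp (C * Real.sqrt (Real.log n))) := by
  refine ⟨15, by norm_num, fun n hn => ?_⟩
  obtain ⟨r, s, hrs, hexp⟩ := exists_exponent_le hn
  refine ⟨(3 * (n * tupleConst n r s ^ (2 * s * r))) ^ ((2 * s) ^ r), fun X hX => ?_⟩
  have hX0 : 0 ≤ X := by linarith
  have htc := one_le_tupleConst n r s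
  refine (countDegN_le (by omega) hrs (by linarith)).trans ?_
  calc (3 * (n * (tupleConst n r s * X ^ (2 / (n : ℝ))) ^ (2 * s * r))) ^ ((2 * s) ^ r)
      = (3 * (n * tupleConst n r s ^ (2 * s * r))) ^ ((2 * s) ^ r) *
          X ^ (2 / (n : ℝ) * (2 * s * r * (2 * s) ^ r)) := by
        have : X ^ (2 / (n : ℝ) * (2 * s * r * (2 * s) ^ r)) =
            ((X ^ (2 / (n : ℝ))) ^ (2 * s * r)) ^ ((2 * s) ^ r) := by
          rw [← pow_mul, ← Real.rpow_natCast (X ^ (2 / (n : ℝ))), ← Real.rpow_mul hX0]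
          push_cast
          rfl
        rw [this, ← mul_pow, mul_pow _ _ (2 * s * r)]
        ring_nf
    _ ≤ _ := by
        gcongr
        linarith
end

section
/- There is a constant C such that for all X ≥ 1, |N_2(X) − (6/π²)·X| ≤ C·√X, where N_2(X) is the number of isomorphism classes of quadratic fields K with |Disc(K)| < X. -/
/-- A quadratic field: a number field of degree 2 over `ℚ`. -/
structure QuadraticField where
  carrier : Type
  [field : Field carrier]
  [nf : NumberField carrier]
  deg : Module.finrank ℚ carrier = 2

attribute [instance] QuadraticField.field QuadraticField.nf

/-- Two quadratic fields are identified if they are isomorphic. -/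
instance QuadraticField.setoid : Setoid QuadraticField where
  r A B := Nonempty (A.carrier ≃+* B.carrier)
  iseqv := ⟨fun _ => ⟨RingEquiv.refl _⟩, fun ⟨e⟩ => ⟨e.symm⟩, fun ⟨e⟩ ⟨f⟩ => ⟨e.trans f⟩⟩

/-- `N₂(X)`: the number of isomorphism classes of quadratic fields with `|Disc(K)| < X`. -/
noncomputable def countQuadratic (X : ℝ) : ℕ :=
  Nat.card {C : Quotient QuadraticField.setoid //
    ∃ K : QuadraticField, ⟦K⟧ = C ∧ |(NumberField.discr K.carrier : ℝ)| < X}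

section ClassificationOfQuadraticFields

open NumberField Module

/-- The ring of integers of a quadratic field has an integral basis `x, y`, and the discriminant is
given by the corresponding trace form. -/
theorem exists_integralBasis_of_finrank_eq_two (K : Type*) [Field K] [NumberField K]
    (hK : finrank ℚ K = 2) :
    ∃ x y : K, IsIntegral ℤ x ∧ IsIntegral ℤ y ∧
      (∀ z : K, IsIntegral ℤ z → ∃ m n : ℤ, z = m * x + n * y) ∧
      (discr K : ℚ) = Algebra.trace ℚ K (x * x) * Algebra.trace ℚ K (y * y) -
        Algebra.trace ℚ K (x * y) ^ 2 := by
  have hcard : Fintype.card (Free.ChooseBasisIndex ℤ (𝓞 K)) = 2 := by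
    rw [← finrank_eq_card_chooseBasisIndex, RingOfIntegers.rank, hK]
  let e := Fintype.equivFinOfCardEq hcard
  let b : Basis (Fin 2) ℤ (𝓞 K) := (RingOfIntegers.basis K).reindex e
  refine ⟨b 0, b 1, (b 0).isIntegral_coe, (b 1).isIntegral_coe, fun z hz ↦ ?_, ?_⟩
  · refine ⟨b.repr ⟨z, hz⟩ 0, b.repr ⟨z, hz⟩ 1, ?_⟩
    have h := congrArg (algebraMap (𝓞 K) K) (b.sum_repr ⟨z, hz⟩)
    rw [Fin.sum_univ_two] at h
    simp only [map_add, zsmul_eq_mul, map_mul, map_intCast] at h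
    exact h.symm
  · rw [coe_discr, ← Algebra.discr_reindex _ (integralBasis K) e, Algebra.discr_def,
      Matrix.det_fin_two]
    simp only [Algebra.traceMatrix_apply, Algebra.traceForm_apply, Function.comp_apply,
      integralBasis_apply, b, Basis.reindex_apply]
    rw [mul_comm (algebraMap (𝓞 K) K (RingOfIntegers.basis K (e.symm 1)))
      (algebraMap (𝓞 K) K (RingOfIntegers.basis K (e.symm 0))), sq]

theorem Rat.sq_ne_intCast_of_squarefree {d : ℤ} (hd : Squarefree d) (h1 : d ≠ 1) (r : ℚ) :
    r ^ 2 ≠ d := by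
  intro h
  have hr : IsIntegral ℤ r := IsIntegral.of_pow two_pos (h ▸ isIntegral_algebraMap (x := d))
  obtain ⟨n, rfl⟩ := IsIntegrallyClosed.isIntegral_iff.1 hr
  have hn : n * n = d := by
    rw [← sq]
    simp only [algebraMap_int_eq, eq_intCast] at h
    exact_mod_cast h
  have := hd n ⟨1, by rw [mul_one, hn]⟩
  rw [← sq, Int.isUnit_sq this] at hn
  exact h1 hn.symm

/-- The field `ℚ(√d)`. -/
abbrev QuadraticExt (d : ℤ) : Type := QuadraticAlgebra ℚ d 0

namespace QuadraticExt

variable {d : ℤ}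

theorem fact (hd : Squarefree d) (h1 : d ≠ 1) :
    Fact (∀ r : ℚ, r ^ 2 ≠ (d : ℚ) + 0 * r) :=
  ⟨fun r ↦ by simpa using Rat.sq_ne_intCast_of_squarefree hd h1 r⟩

variable [Fact (∀ r : ℚ, r ^ 2 ≠ (d : ℚ) + 0 * r)]

instance : NumberField (QuadraticExt d) where
  to_charZero := inferInstance
  to_finiteDimensional := by
    convert! (inferInstance : Module.Finite ℚ (QuadraticAlgebra ℚ (d : ℚ) 0))

omit [Fact (∀ r : ℚ, r ^ 2 ≠ (d : ℚ) + 0 * r)] in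
theorem finrank_eq_two : finrank ℚ (QuadraticExt d) = 2 := by
  convert! QuadraticAlgebra.finrank_eq_two (d : ℚ) (0 : ℚ)

theorem trace_apply (z : QuadraticExt d) : Algebra.trace ℚ (QuadraticExt d) z = 2 * z.re := by
  rw [Algebra.trace_eq_matrix_trace (QuadraticAlgebra.basis (d : ℚ) 0), Matrix.trace_fin_two]
  have h0 : QuadraticAlgebra.basis (d : ℚ) 0 0 = ⟨1, 0⟩ := by
    simp [QuadraticAlgebra.basis]
  have h1 : QuadraticAlgebra.basis (d : ℚ) 0 1 = ⟨0, 1⟩ := by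
    simp [QuadraticAlgebra.basis]
  simp [Algebra.leftMulMatrix_eq_repr_mul, h0, h1]
  ring

theorem exists_intCast_eq_of_isIntegral_mk {q : ℚ} (h : IsIntegral ℤ (⟨q, 0⟩ : QuadraticExt d)) :
    ∃ n : ℤ, (n : ℚ) = q := by
  have h' : IsIntegral ℤ (algebraMap ℚ (QuadraticExt d) q) := h
  rw [isIntegral_algebraMap_iff QuadraticAlgebra.algebraMap_injective] at h'
  exact IsIntegrallyClosed.isIntegral_iff.1 h'

theorem exists_intCast_eq_two_mul_re {z : QuadraticExt d} (hz : IsIntegral ℤ z) :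
    ∃ n : ℤ, (n : ℚ) = 2 * z.re := by
  have h := hz.add (hz.map (starRingEnd (QuadraticExt d)).toIntAlgHom)
  refine exists_intCast_eq_of_isIntegral_mk (d := d) ?_
  have h2 : z + star z = ⟨2 * z.re, 0⟩ := by
    ext <;> simp
    ring
  rwa [← h2]

theorem exists_intCast_eq_norm {z : QuadraticExt d} (hz : IsIntegral ℤ z) :
    ∃ n : ℤ, (n : ℚ) = z.re ^ 2 - d * z.im ^ 2 := by
  have h := hz.mul (hz.map (starRingEnd (QuadraticExt d)).toIntAlgHom)
  refine exists_intCast_eq_of_isIntegral_mk (d := d) ?_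
  have h2 : z * star z = ⟨z.re ^ 2 - d * z.im ^ 2, 0⟩ := by
    ext <;> simp <;> ring
  rwa [← h2]

/-- The discriminant of `ℚ(√d)`. -/
def disc (d : ℤ) : ℤ := if d % 4 = 1 then d else 4 * d

theorem isIntegral_omega : IsIntegral ℤ (⟨0, 1⟩ : QuadraticExt d) := by
  refine IsIntegral.of_pow two_pos ?_
  have : (⟨0, 1⟩ : QuadraticExt d) ^ 2 = (algebraMap ℤ _ d) := by
    ext <;> simp [sq]
  rw [this]
  exact isIntegral_algebraMap

theorem isIntegral_half (h4 : d % 4 = 1) : IsIntegral ℤ (⟨1 / 2, 1 / 2⟩ : QuadraticExt d) := by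
  obtain ⟨k, hk⟩ : ∃ k, d = 4 * k + 1 := ⟨d / 4, by omega⟩
  refine ⟨Polynomial.X ^ 2 - Polynomial.X - Polynomial.C k, by monicity!, ?_⟩
  simp only [Polynomial.eval₂_sub, Polynomial.eval₂_pow, Polynomial.eval₂_X, Polynomial.eval₂_C]
  have hkq : (d : ℚ) = 4 * k + 1 := by exact_mod_cast hk
  ext <;> simp [sq, hkq] <;> ring

theorem discr_eq_disc (hd : Squarefree d) : discr (QuadraticExt d) = disc d := by
  obtain ⟨⟨p, q⟩, ⟨r, t⟩, hx, hy, hspan, hD⟩ :=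
    exists_integralBasis_of_finrank_eq_two (QuadraticExt d) finrank_eq_two
  obtain ⟨tx, htx⟩ := exists_intCast_eq_two_mul_re hx
  obtain ⟨ty, hty⟩ := exists_intCast_eq_two_mul_re hy
  obtain ⟨txy, htxy⟩ := exists_intCast_eq_two_mul_re (IsIntegral.mul hx hy)
  obtain ⟨nx, hnx⟩ := exists_intCast_eq_norm hx
  obtain ⟨ny, hny⟩ := exists_intCast_eq_norm hy
  simp only [trace_apply, QuadraticAlgebra.mk_mul_mk] at hD htx hty htxy hnx hny
  set D := discr (QuadraticExt d)
  have hD' : (D : ℚ) = 4 * d * (p * t - q * r) ^ 2 := by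
    rw [hD]; ring
  have hmod : D = (tx * ty - txy) ^ 2 - 4 * (nx * ny) := by
    have : (D : ℚ) = (tx * ty - txy) ^ 2 - 4 * (nx * ny) := by
      rw [hD', htx, hty, htxy, hnx, hny]; ring
    exact_mod_cast this
  have hcoord (u v : ℚ) (h : IsIntegral ℤ (⟨u, v⟩ : QuadraticExt d)) :
      ∃ a b : ℤ, u = a * p + b * r ∧ v = a * q + b * t := by
    obtain ⟨a, b, hab⟩ := hspan _ h
    refine ⟨a, b, ?_, ?_⟩
    · simpa using congrArg QuadraticAlgebra.re hab
    · simpa using congrArg QuadraticAlgebra.im hab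
  obtain ⟨a, b, hab, hab'⟩ := hcoord 1 0 isIntegral_one
  have hD4 : D % 4 = 0 ∨ D % 4 = 1 := by
    rw [hmod]
    rcases Int.even_or_odd' (tx * ty - txy) with ⟨k, hk | hk⟩
    · left; rw [hk]; ring_nf; omega
    · right; rw [hk]; ring_nf; omega
  unfold disc
  split_ifs with h4
  · obtain ⟨c, e, hce, hce'⟩ := hcoord _ _ (isIntegral_half h4)
    have h : (a * e - b * c) ^ 2 * D = d := by
      have : ((a * e - b * c) ^ 2 * D : ℚ) = d := by
        have h1 : ((a * e - b * c) * (p * t - q * r) : ℚ) = 1 / 2 := by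
          linear_combination (- c * q - e * t) * hab + (c * p + e * r) * hab' - hce'
        rw [hD']
        linear_combination (4 * d * ((a * e - b * c) * (p * t - q * r) + 1 / 2) : ℚ) * h1
      exact_mod_cast this
    have hu := hd (a * e - b * c) ⟨D, by rw [← h, sq]⟩
    rwa [Int.isUnit_sq hu, one_mul] at h
  · obtain ⟨c, e, hce, hce'⟩ := hcoord _ _ isIntegral_omega
    have h : (a * e - b * c) ^ 2 * D = 4 * d := by
      have : ((a * e - b * c) ^ 2 * D : ℚ) = 4 * d := by
        have h1 : ((a * e - b * c) * (p * t - q * r) : ℚ) = 1 := by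
          linear_combination (- c * q - e * t) * hab + (c * p + e * r) * hab' - hce'
        rw [hD']
        linear_combination (4 * d * ((a * e - b * c) * (p * t - q * r) + 1) : ℚ) * h1
      exact_mod_cast this
    rcases Int.even_or_odd' (a * e - b * c) with ⟨m, hm | hm⟩
    · have h' : m * m * D = d := by
        rw [hm] at h
        linarith
      have hu := hd m ⟨D, h'.symm⟩
      rw [← sq, Int.isUnit_sq hu, one_mul] at h'
      have := hd 2
      grind [Int.isUnit_iff]
    · have hco : IsCoprime (2 * m + 1) 4 := ⟨1 - 2 * m, m ^ 2, by ring⟩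
      have hdvd : (2 * m + 1) * (2 * m + 1) ∣ d :=
        (hco.mul_left hco).dvd_of_dvd_mul_left ⟨D, by rw [← h, hm, sq]⟩
      rwa [hm, Int.isUnit_sq (hd _ hdvd), one_mul] at h

end QuadraticExt

theorem exists_sq_eq_of_finrank_eq_two (K : Type*) [Field K] [NumberField K]
    (hK : finrank ℚ K = 2) :
    ∃ d : ℤ, Squarefree d ∧ d ≠ 1 ∧ ∃ s : K, s ^ 2 = d := by
  obtain ⟨α, hα⟩ : ∃ α : K, α ∉ (algebraMap ℚ K).range := by
    by_contra! h
    have : (⊥ : Subalgebra ℚ K) = ⊤ := eq_top_iff.2 fun x _ ↦ Algebra.mem_bot.2 (h x)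
    rw [Subalgebra.bot_eq_top_iff_finrank_eq_one, hK] at this
    omega
  have hintegral : IsIntegral ℚ α := Algebra.IsIntegral.isIntegral α
  have hdeg : (minpoly ℚ α).natDegree = 2 :=
    le_antisymm (hK ▸ minpoly.natDegree_le α) ((minpoly.two_le_natDegree_iff hintegral).2 hα)
  have hmin := minpoly.aeval ℚ α
  rw [(minpoly.monic hintegral).as_sum, hdeg] at hmin
  simp only [Finset.sum_range_succ, Finset.sum_range_zero, map_add, map_mul, map_pow,
    Polynomial.aeval_X, Polynomial.aeval_C, pow_zero, pow_one, mul_one, zero_add] at hmin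
  set u := (minpoly ℚ α).coeff 0
  set v := (minpoly ℚ α).coeff 1
  set e := v ^ 2 - 4 * u with he
  have hs : (2 * α + algebraMap ℚ K v) ^ 2 = algebraMap ℚ K e := by
    simp only [he, map_sub, map_mul, map_pow, map_ofNat]
    linear_combination 4 * hmin
  have he0 : e.num * e.den ≠ 0 := by
    simp only [ne_eq, mul_eq_zero, Rat.num_eq_zero, Nat.cast_eq_zero, Rat.den_ne_zero, or_false]
    intro h0
    rw [h0, map_zero, sq_eq_zero_iff] at hs
    refine hα ⟨-v / 2, ?_⟩
    simp only [map_div₀, map_neg, map_ofNat]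
    linear_combination -hs / 2
  obtain ⟨a, f, hf, ha⟩ := Nat.sq_mul_squarefree (e.num * e.den).natAbs
  obtain ⟨d, hd, hdf⟩ : ∃ d : ℤ, Squarefree d ∧ (f : ℤ) ^ 2 * d = e.num * e.den := by
    rcases Int.natAbs_eq (e.num * e.den) with h | h
    · exact ⟨a, Int.squarefree_natCast.2 ha, by rw [h, ← hf]; push_cast; ring⟩
    · exact ⟨-a, by rwa [← Int.squarefree_natAbs, Int.natAbs_neg, Int.natAbs_natCast],
        by rw [h, ← hf]; push_cast; ring⟩
  have hf0 : (f : K) ≠ 0 := by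
    rintro h
    rw [Nat.cast_eq_zero] at h
    exact he0 (by rw [← hdf, h]; simp)
  have hsd : ((2 * α + algebraMap ℚ K v) * e.den / f) ^ 2 = d := by
    rw [div_pow, mul_pow, hs, div_eq_iff (pow_ne_zero 2 hf0)]
    have h1 : e * e.den = e.num := Rat.mul_den_eq_num e
    have h2 : (algebraMap ℚ K e) * e.den = e.num := by
      have := congrArg (algebraMap ℚ K) h1
      simpa only [map_mul, map_natCast, map_intCast] using this
    have h3 : (f : K) ^ 2 * d = e.num * e.den := by exact_mod_cast congrArg (Int.cast : ℤ → K) hdf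
    linear_combination e.den * h2 - h3
  refine ⟨d, hd, ?_, _, hsd⟩
  rintro rfl
  have hden : (e.den : K) ≠ 0 := by exact_mod_cast e.den_ne_zero
  rw [Int.cast_one, sq_eq_one_iff, div_eq_iff hf0, div_eq_iff hf0] at hsd
  apply hα
  rcases hsd with h | h
  · refine ⟨(f / e.den - v) / 2, ?_⟩
    simp only [map_div₀, map_sub, map_natCast, map_ofNat]
    field_simp
    linear_combination -h
  · refine ⟨(- f / e.den - v) / 2, ?_⟩
    simp only [map_div₀, map_sub, map_neg, map_natCast, map_ofNat]
    field_simp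
    linear_combination -h

theorem nonempty_quadraticExt_ringEquiv {K : Type*} [Field K] [NumberField K]
    (hK : finrank ℚ K = 2) {d : ℤ} [Fact (∀ r : ℚ, r ^ 2 ≠ (d : ℚ) + 0 * r)]
    {s : K} (hs : s ^ 2 = d) :
    Nonempty (QuadraticExt d ≃+* K) := by
  let φ : QuadraticExt d →+* K := (QuadraticAlgebra.lift (R := ℚ) (A := K) (a := d) (b := 0)
    ⟨s, by rw [← sq, hs]; simp [Algebra.smul_def]⟩).toRingHom
  let ψ : QuadraticExt d →ₐ[ℚ] K := φ.toRatAlgHom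
  have hinj : Function.Injective ψ := ψ.toRingHom.injective
  have hsurj : Function.Surjective ψ :=
    (LinearMap.injective_iff_surjective_of_finrank_eq_finrank (f := ψ.toLinearMap)
      (by rw [hK, QuadraticExt.finrank_eq_two])).1 hinj
  exact ⟨RingEquiv.ofBijective ψ ⟨hinj, hsurj⟩⟩

namespace QuadraticField

/-- The field `ℚ(√d)` as a quadratic field, for squarefree `d ≠ 1`. -/
noncomputable def ofSquarefree (d : ℤ) (hd : Squarefree d) (h1 : d ≠ 1) : QuadraticField :=
  let := QuadraticExt.fact hd h1
  { carrier := QuadraticExt d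
    deg := QuadraticExt.finrank_eq_two }

theorem discr_ofSquarefree {d : ℤ} (hd : Squarefree d) (h1 : d ≠ 1) :
    discr (ofSquarefree d hd h1).carrier = QuadraticExt.disc d :=
  let := QuadraticExt.fact hd h1
  QuadraticExt.discr_eq_disc hd

theorem exists_equiv_ofSquarefree (K : QuadraticField) :
    ∃ (d : ℤ) (hd : Squarefree d) (h1 : d ≠ 1), ofSquarefree d hd h1 ≈ K := by
  obtain ⟨d, hd, h1, s, hs⟩ := exists_sq_eq_of_finrank_eq_two K.carrier K.deg
  let := QuadraticExt.fact hd h1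
  exact ⟨d, hd, h1, nonempty_quadraticExt_ringEquiv K.deg hs⟩

theorem discr_eq_of_equiv {K L : QuadraticField} (h : K ≈ L) :
    discr K.carrier = discr L.carrier :=
  h.elim fun e ↦ discr_eq_discr_of_ringEquiv _ e

end QuadraticField

theorem QuadraticExt.disc_injOn : Set.InjOn QuadraticExt.disc {d | Squarefree d} := by
  intro d hd e he h
  unfold QuadraticExt.disc at h
  grind

theorem countQuadratic_eq_ncard (X : ℝ) :
    countQuadratic X =
      {d : ℤ | Squarefree d ∧ d ≠ 1 ∧ |(QuadraticExt.disc d : ℝ)| < X}.ncard := by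
  rw [← Nat.card_coe_set_eq]
  symm
  refine Nat.card_congr (Equiv.ofBijective
    (fun d ↦ ⟨⟦QuadraticField.ofSquarefree d.1 d.2.1 d.2.2.1⟧, _, rfl, ?_⟩) ⟨?_, ?_⟩)
  · rw [QuadraticField.discr_ofSquarefree]
    exact d.2.2.2
  · intro d e h
    have h' := QuadraticField.discr_eq_of_equiv (Quotient.exact (Subtype.ext_iff.1 h))
    rw [QuadraticField.discr_ofSquarefree, QuadraticField.discr_ofSquarefree] at h'
    exact Subtype.ext (QuadraticExt.disc_injOn d.2.1 e.2.1 h')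
  · rintro ⟨_, K, rfl, hK⟩
    obtain ⟨d, hd, h1, h⟩ := K.exists_equiv_ofSquarefree
    refine ⟨⟨d, hd, h1, ?_⟩, Subtype.ext (Quotient.sound h)⟩
    rwa [← QuadraticField.discr_ofSquarefree hd h1, QuadraticField.discr_eq_of_equiv h]

end ClassificationOfQuadraticFields

open Finset in
theorem Nat.sum_moebius_of_sq_dvd {n K : ℕ} (hn : n ≠ 0) (hK : ∀ k, k ^ 2 ∣ n → k < K) :
    ∑ k ∈ range K with k ^ 2 ∣ n, ArithmeticFunction.moebius k = if Squarefree n then 1 else 0 := by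
  obtain ⟨a, b, rfl, ha⟩ := Nat.sq_mul_squarefree n
  have hb : b ≠ 0 := by rintro rfl; simp at hn
  have hdvd (k : ℕ) : k ^ 2 ∣ b ^ 2 * a ↔ k ∣ b := by
    refine ⟨fun h ↦ ?_, fun h ↦ (pow_dvd_pow_of_dvd h 2).mul_right a⟩
    obtain ⟨g, k', b', hg, hco, rfl, rfl⟩ := Nat.exists_coprime' (m := k) (n := b)
      (Nat.gcd_pos_of_pos_right _ (Nat.pos_of_ne_zero hb))
    rw [mul_pow, mul_pow, mul_right_comm] at h
    have h1 : k' ^ 2 ∣ a := (hco.pow 2 2).dvd_of_dvd_mul_left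
      (Nat.dvd_of_mul_dvd_mul_right (pow_pos hg 2) h)
    rw [sq] at h1
    rw [Nat.isUnit_iff.1 (ha _ h1), one_mul]
    exact dvd_mul_left g b'
  have hfil : {k ∈ range K | k ^ 2 ∣ b ^ 2 * a} = b.divisors := by
    ext k
    simp only [mem_filter, mem_range, Nat.mem_divisors, hdvd]
    exact ⟨fun h ↦ ⟨h.2, hb⟩, fun h ↦ ⟨hK k ((hdvd k).2 h.1), h.1⟩⟩
  rw [hfil, ← ArithmeticFunction.coe_mul_zeta_apply, ArithmeticFunction.moebius_mul_coe_zeta,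
    ArithmeticFunction.one_apply]
  refine if_congr ⟨?_, fun h ↦ ?_⟩ rfl rfl
  · rintro rfl
    simpa using ha
  · exact Nat.isUnit_iff.1 (h b (by rw [← sq]; exact dvd_mul_right _ _))

open Finset in
theorem Nat.card_filter_odd_range (M : ℕ) : #{n ∈ range M | Odd n} = M / 2 := by
  induction M with
  | zero => rfl
  | succ M ih =>
    rw [range_add_one, filter_insert]
    split_ifs with h
    · rw [card_insert_of_notMem (by simp), ih]
      grind
    · rw [ih]
      grind

open Finset in
theorem Nat.card_filter_odd_and_sq_dvd {k : ℕ} (hk : Odd k) (X : ℝ) :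
    #{n ∈ range ⌈X⌉₊ | Odd n ∧ k ^ 2 ∣ n} = ⌈X / k ^ 2⌉₊ / 2 := by
  rw [← Nat.card_filter_odd_range]
  have hk0 : 0 < k ^ 2 := pow_pos hk.pos 2
  symm
  refine card_bij (fun m _ ↦ k ^ 2 * m) ?_ ?_ ?_
  · intro m hm
    simp only [mem_filter, mem_range, Nat.lt_ceil] at hm ⊢
    rw [lt_div_iff₀ (by exact_mod_cast hk0)] at hm
    refine ⟨?_, (hk.pow).mul hm.2, dvd_mul_right _ _⟩
    push_cast
    linarith
  · intro m _ m' _ h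
    exact Nat.eq_of_mul_eq_mul_left hk0 h
  · intro n hn
    simp only [mem_filter, mem_range, Nat.lt_ceil] at hn
    obtain ⟨hn, hodd, m, rfl⟩ := hn
    refine ⟨m, ?_, rfl⟩
    simp only [mem_filter, mem_range, Nat.lt_ceil]
    rw [lt_div_iff₀ (by exact_mod_cast hk0)]
    push_cast at hn
    exact ⟨by linarith, (Nat.odd_mul.1 hodd).2⟩

theorem abs_natCast_ceil_div_two_sub_le {Y : ℝ} (hY : 0 ≤ Y) :
    |((⌈Y⌉₊ / 2 : ℕ) : ℝ) - Y / 2| ≤ 1 := by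
  have h1 := Nat.le_ceil Y
  have h2 := Nat.ceil_lt_add_one hY
  have h3 : ((⌈Y⌉₊ : ℕ) : ℝ) = 2 * (⌈Y⌉₊ / 2 : ℕ) + (⌈Y⌉₊ % 2 : ℕ) := by
    exact_mod_cast (Nat.div_add_mod _ 2).symm
  have h4 : ((⌈Y⌉₊ % 2 : ℕ) : ℝ) ≤ 1 := by exact_mod_cast Nat.le_of_lt_succ (Nat.mod_lt _ two_pos)
  have h5 : (0 : ℝ) ≤ (⌈Y⌉₊ % 2 : ℕ) := Nat.cast_nonneg _
  rw [abs_le]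
  constructor <;> linarith

/-- The coefficients `μ(k) / k²` for odd `k`, and zero otherwise. -/
noncomputable def oddMoebiusInvSq (k : ℕ) : ℝ :=
  if Odd k then (ArithmeticFunction.moebius k : ℝ) / k ^ 2 else 0

theorem abs_oddMoebiusInvSq_le (k : ℕ) : |oddMoebiusInvSq k| ≤ ((k : ℝ) ^ 2)⁻¹ := by
  unfold oddMoebiusInvSq
  split_ifs
  · rw [abs_div, abs_of_nonneg (sq_nonneg (k : ℝ)), div_eq_mul_inv]
    refine mul_le_of_le_one_left (by positivity) ?_
    exact_mod_cast ArithmeticFunction.abs_moebius_le_one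
  · simp

theorem hasSum_oddMoebiusInvSq : HasSum oddMoebiusInvSq (8 / Real.pi ^ 2) := by
  have hsum : Summable oddMoebiusInvSq :=
    .of_norm_bounded (Real.summable_nat_pow_inv.2 one_lt_two) abs_oddMoebiusInvSq_le
  have h2 : (1 : ℝ) < (2 : ℂ).re := by norm_num
  have h := DirichletCharacter.LSeries.mul_mu_eq_one (1 : DirichletCharacter ℂ 2) h2
  rw [← DirichletCharacter.LFunction_eq_LSeries _ h2] at h
  have h3 := DirichletCharacter.LFunctionTrivChar_eq_mul_riemannZeta (N := 2) (s := 2) (by norm_num)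
  rw [DirichletCharacter.LFunctionTrivChar] at h3
  rw [h3, riemannZeta_two, Nat.prime_two.primeFactors, Finset.prod_singleton] at h
  have hterm : LSeries (fun n ↦ (1 : DirichletCharacter ℂ 2) (n : ZMod 2) *
      (ArithmeticFunction.moebius n : ℂ)) 2 =
      ((∑' k, oddMoebiusInvSq k : ℝ) : ℂ) := by
    rw [LSeries, Complex.ofReal_tsum]
    refine tsum_congr fun n ↦ ?_
    rw [LSeries.term_def, oddMoebiusInvSq]
    rcases eq_or_ne n 0 with rfl | hn
    · simp
    rw [if_neg hn]
    by_cases hodd : Odd n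
    · rw [if_pos hodd, MulChar.one_apply ((ZMod.isUnit_iff_coprime n 2).2 hodd.coprime_two_right),
        one_mul, Complex.cpow_ofNat]
      push_cast
      rfl
    · rw [if_neg hodd, MulChar.map_nonunit _ fun h ↦ hodd
        (Nat.coprime_two_right.1 ((ZMod.isUnit_iff_coprime n 2).1 h))]
      simp
  have h' : ((1 - (2 : ℂ) ^ (-2 : ℂ)) * (Real.pi ^ 2 / 6)) *
      ((∑' k, oddMoebiusInvSq k : ℝ) : ℂ) = 1 := by
    rw [← hterm]
    exact_mod_cast h
  have h5 : (2 : ℂ) ^ (-2 : ℂ) = 1 / 4 := by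
    rw [Complex.cpow_neg]
    norm_num
  rw [h5] at h'
  have h6 : ((1 - 1 / 4) * (Real.pi ^ 2 / 6)) * (∑' k, oddMoebiusInvSq k) = 1 := by
    apply Complex.ofReal_injective
    rw [Complex.ofReal_mul, Complex.ofReal_one, ← h']
    push_cast
    rfl
  rw [hsum.hasSum_iff, eq_div_iff (by positivity)]
  linarith

open Finset in
theorem abs_sum_range_oddMoebiusInvSq_sub_le {K : ℕ} (hK : 0 < K) :
    |(∑ k ∈ range K, oddMoebiusInvSq k) - 8 / Real.pi ^ 2| ≤ 2 / (K : ℝ) := by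
  rw [abs_sub_comm]
  refine le_of_tendsto ((hasSum_oddMoebiusInvSq.tendsto_sum_nat.sub_const _).abs)
    (Filter.eventually_atTop.2 ⟨K, fun n hn ↦ ?_⟩)
  rw [← sum_Ico_eq_sub _ hn]
  obtain ⟨j, rfl⟩ := Nat.exists_eq_add_of_lt hK
  calc |∑ k ∈ Ico (0 + j + 1) n, oddMoebiusInvSq k|
      ≤ ∑ k ∈ Ico (0 + j + 1) n, |oddMoebiusInvSq k| := abs_sum_le_sum_abs _ _
    _ ≤ ∑ k ∈ Ioo j n, ((k : ℝ) ^ 2)⁻¹ := by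
      rw [show Ico (0 + j + 1) n = Ioo j n by ext; simp]
      exact sum_le_sum fun k _ ↦ abs_oddMoebiusInvSq_le k
    _ ≤ 2 / (j + 1) := sum_Ioo_inv_sq_le j n
    _ = 2 / ((0 + j + 1 : ℕ) : ℝ) := by push_cast; ring

open Finset in
/-- The odd squarefree natural numbers smaller than `X`. -/
noncomputable def oddSquarefree (X : ℝ) : Finset ℕ := {n ∈ range ⌈X⌉₊ | Odd n ∧ Squarefree n}

theorem mem_oddSquarefree {X : ℝ} {n : ℕ} :
    n ∈ oddSquarefree X ↔ (n : ℝ) < X ∧ Odd n ∧ Squarefree n := by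
  simp [oddSquarefree, Nat.lt_ceil]

open Finset in
theorem card_oddSquarefree_eq_sum (X : ℝ) :
    (#(oddSquarefree X) : ℝ) = ∑ k ∈ range ⌈√X⌉₊,
      if Odd k then (ArithmeticFunction.moebius k : ℝ) * (⌈X / k ^ 2⌉₊ / 2 : ℕ) else 0 := by
  have h1 : (#(oddSquarefree X) : ℤ) = ∑ n ∈ range ⌈X⌉₊ with Odd n,
      ∑ k ∈ range ⌈√X⌉₊ with k ^ 2 ∣ n, ArithmeticFunction.moebius k := by
    rw [oddSquarefree, ← filter_filter, card_filter]
    push_cast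
    refine sum_congr rfl fun n hn ↦ (Nat.sum_moebius_of_sq_dvd ?_ fun k hk ↦ ?_).symm
    · rintro rfl
      simp at hn
    · simp only [mem_filter, mem_range, Nat.lt_ceil] at hn ⊢
      refine Real.lt_sqrt_of_sq_lt (lt_of_le_of_lt ?_ hn.1)
      exact_mod_cast Nat.le_of_dvd hn.2.pos hk
  have h2 : (#(oddSquarefree X) : ℤ) = ∑ k ∈ range ⌈√X⌉₊,
      if Odd k then ArithmeticFunction.moebius k * (⌈X / k ^ 2⌉₊ / 2 : ℕ) else 0 := by
    rw [h1]
    simp_rw [sum_filter (s := range ⌈√X⌉₊)]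
    rw [sum_comm]
    refine sum_congr rfl fun k _ ↦ ?_
    rw [← sum_filter, filter_filter, sum_const, nsmul_eq_mul]
    split_ifs with hk
    · rw [Nat.card_filter_odd_and_sq_dvd hk, mul_comm]
    · rw [filter_eq_empty_iff.2, card_empty, Nat.cast_zero, zero_mul]
      rintro n - ⟨hn, hkn⟩
      exact hk (Nat.Odd.of_mul_left (m := k) (n := k) (by
        rw [← sq]; exact hn.of_dvd_nat hkn))
  rw [← Int.cast_natCast, h2, Int.cast_sum]
  refine sum_congr rfl fun k _ ↦ ?_
  rw [apply_ite (Int.cast : ℤ → ℝ), Int.cast_mul, Int.cast_natCast, Int.cast_zero]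

open Finset in
theorem abs_card_oddSquarefree_sub_le {X : ℝ} (hX : 0 < X) :
    |(#(oddSquarefree X) : ℝ) - 4 / Real.pi ^ 2 * X| ≤ 2 * √X + 1 := by
  set K := ⌈√X⌉₊ with hKdef
  have hs : 0 < √X := Real.sqrt_pos.2 hX
  have hK0 : 0 < K := Nat.ceil_pos.2 hs
  have hK1 : √X ≤ K := Nat.le_ceil _
  have hK2 : (K : ℝ) < √X + 1 := Nat.ceil_lt_add_one hs.le
  have h1 : |(#(oddSquarefree X) : ℝ) - X / 2 * (∑ k ∈ range K, oddMoebiusInvSq k)| ≤ K := by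
    rw [card_oddSquarefree_eq_sum, mul_sum, ← sum_sub_distrib]
    refine (abs_sum_le_sum_abs _ _).trans ((sum_le_card_nsmul _ _ 1 fun k _ ↦ ?_).trans
      (by rw [card_range, nsmul_eq_mul, mul_one]))
    rw [oddMoebiusInvSq]
    split_ifs
    · rw [show ∀ m c : ℝ, m * c - X / 2 * (m / k ^ 2) = m * (c - X / k ^ 2 / 2) by intros; ring,
        abs_mul]
      refine mul_le_one₀ ?_ (abs_nonneg _) (abs_natCast_ceil_div_two_sub_le (by positivity))
      exact_mod_cast ArithmeticFunction.abs_moebius_le_one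
    · simp
  have h2 : |X / 2 * (∑ k ∈ range K, oddMoebiusInvSq k) - 4 / Real.pi ^ 2 * X| ≤ √X := by
    rw [show ∀ S : ℝ, X / 2 * S - 4 / Real.pi ^ 2 * X = X / 2 * (S - 8 / Real.pi ^ 2) by
      intros; ring, abs_mul, abs_of_pos (half_pos hX)]
    calc X / 2 * _ ≤ X / 2 * (2 / K) := by
          gcongr
          exact abs_sum_range_oddMoebiusInvSq_sub_le hK0
      _ ≤ X / 2 * (2 / √X) := by gcongr
      _ = √X := by
          field_simp
          rw [Real.sq_sqrt hX.le]
  calc _ ≤ _ := abs_sub_le _ (X / 2 * ∑ k ∈ range K, oddMoebiusInvSq k) _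
    _ ≤ 2 * √X + 1 := by linarith

theorem Nat.squarefree_two_mul_iff {n : ℕ} : Squarefree (2 * n) ↔ Odd n ∧ Squarefree n := by
  rw [Nat.squarefree_mul_iff, Nat.coprime_two_left]
  simp [Nat.prime_two.squarefree]

theorem Int.natAbs_injOn_emod_four (r : ℤ) (hr : Odd r) : Set.InjOn Int.natAbs {d | d % 4 = r} := by
  intro d hd e he h
  simp only [Set.mem_ofPred_eq] at hd he
  grind

theorem Int.exists_natAbs_eq_and_emod_four {n : ℕ} (hn : Odd n) {r : ℤ} (hr : r = 1 ∨ r = 3) :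
    ∃ d : ℤ, d % 4 = r ∧ d.natAbs = n := by
  by_cases h : (n : ℤ) % 4 = r
  · exact ⟨n, h, by simp⟩
  · exact ⟨-n, by grind, by simp⟩

theorem ncard_squarefree_emod_four (X : ℝ) {r : ℤ} (hr : r = 1 ∨ r = 3) :
    {d : ℤ | Squarefree d ∧ d % 4 = r ∧ |(d : ℝ)| < X}.ncard = (oddSquarefree X).card := by
  rw [← Set.ncard_coe_finset]
  refine Set.ncard_congr (fun d _ ↦ d.natAbs) ?_ ?_ ?_
  · rintro d ⟨hd, hdr, hX⟩
    rw [Finset.mem_coe, mem_oddSquarefree, Nat.cast_natAbs, Int.cast_abs]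
    exact ⟨hX, by grind, Int.squarefree_natAbs.2 hd⟩
  · rintro d e ⟨-, hd, -⟩ ⟨-, he, -⟩ h
    exact Int.natAbs_injOn_emod_four r (by grind) hd he h
  · intro n hn
    rw [Finset.mem_coe, mem_oddSquarefree] at hn
    obtain ⟨d, hd, rfl⟩ := Int.exists_natAbs_eq_and_emod_four hn.2.1 hr
    rw [Nat.cast_natAbs, Int.cast_abs, Int.squarefree_natAbs] at hn
    exact ⟨d, ⟨hn.2.2, hd, hn.1⟩, rfl⟩

theorem ncard_squarefree_even (X : ℝ) {ε : ℤ} (hε : ε = 1 ∨ ε = -1) :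
    {d : ℤ | Squarefree d ∧ d % 2 = 0 ∧ 0 < ε * d ∧ |(d : ℝ)| < X}.ncard =
      (oddSquarefree (X / 2)).card := by
  rw [← Set.ncard_coe_finset]
  symm
  have habs (n : ℕ) : (ε * (2 * n)).natAbs = 2 * n := by
    rcases hε with rfl | rfl <;> simp [Int.natAbs_mul]
  refine Set.ncard_congr (fun n _ ↦ ε * (2 * n)) ?_ ?_ ?_
  · intro n hn
    rw [Finset.mem_coe, mem_oddSquarefree, ← Nat.squarefree_two_mul_iff] at hn
    refine ⟨?_, by grind, ?_, ?_⟩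
    · rw [← Int.squarefree_natAbs, habs]
      exact hn.2
    · have : n ≠ 0 := by
        rintro rfl
        simp at hn
      rcases hε with rfl | rfl <;> lia
    · rw [← Int.cast_abs, ← Nat.cast_natAbs, habs]
      push_cast
      linarith
  · intro m n _ _ h
    rcases hε with rfl | rfl <;> grind
  · rintro d ⟨hd, hd2, hpos, hX⟩
    obtain ⟨n, hn⟩ : ∃ n : ℕ, d = ε * (2 * n) :=
      ⟨d.natAbs / 2, by rcases hε with rfl | rfl <;> lia⟩
    subst hn
    refine ⟨n, ?_, rfl⟩
    rw [← Int.squarefree_natAbs, habs] at hd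
    rw [← Int.cast_abs, ← Nat.cast_natAbs, habs] at hX
    rw [Finset.mem_coe, mem_oddSquarefree, ← Nat.squarefree_two_mul_iff]
    push_cast at hX
    exact ⟨by linarith, hd⟩

theorem finite_abs_intCast_lt (X : ℝ) : {d : ℤ | |(d : ℝ)| < X}.Finite := by
  refine (Set.finite_Icc (-⌈X⌉) ⌈X⌉).subset fun d hd ↦ ?_
  have h := abs_lt.1 (lt_of_lt_of_le hd (Int.le_ceil X))
  exact ⟨by exact_mod_cast h.1.le, by exact_mod_cast h.2.le⟩

theorem ncard_squarefree_abs_disc_lt (X : ℝ) :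
    {d : ℤ | Squarefree d ∧ |(QuadraticExt.disc d : ℝ)| < X}.ncard =
      (oddSquarefree X).card + (oddSquarefree (X / 4)).card +
        2 * (oddSquarefree (X / 8)).card := by
  have hset : {d : ℤ | Squarefree d ∧ |(QuadraticExt.disc d : ℝ)| < X} =
      ({d : ℤ | Squarefree d ∧ d % 4 = 1 ∧ |(d : ℝ)| < X} ∪
      {d : ℤ | Squarefree d ∧ d % 4 = 3 ∧ |(d : ℝ)| < X / 4}) ∪
      ({d : ℤ | Squarefree d ∧ d % 2 = 0 ∧ 0 < 1 * d ∧ |(d : ℝ)| < X / 4} ∪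
      {d : ℤ | Squarefree d ∧ d % 2 = 0 ∧ 0 < (-1) * d ∧ |(d : ℝ)| < X / 4}) := by
    ext d
    have hdisc : |(QuadraticExt.disc d : ℝ)| < X ↔
        d % 4 = 1 ∧ |(d : ℝ)| < X ∨ d % 4 ≠ 1 ∧ |(d : ℝ)| < X / 4 := by
      by_cases h : d % 4 = 1
      · simp [QuadraticExt.disc, h]
      · simp [QuadraticExt.disc, h, abs_mul, lt_div_iff₀' (zero_lt_four (α := ℝ))]
    have h0 : Squarefree d → d ≠ 0 := Squarefree.ne_zero
    simp only [Set.mem_ofPred_eq, Set.mem_union, hdisc]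
    grind
  have hfin (r Y) : {d : ℤ | Squarefree d ∧ d % 4 = r ∧ |(d : ℝ)| < Y}.Finite :=
    (finite_abs_intCast_lt Y).subset fun d hd ↦ hd.2.2
  have hfin2 (ε : ℤ) (Y) : {d : ℤ | Squarefree d ∧ d % 2 = 0 ∧ 0 < ε * d ∧ |(d : ℝ)| < Y}.Finite :=
    (finite_abs_intCast_lt Y).subset fun d hd ↦ hd.2.2.2
  rw [hset, Set.ncard_union_eq _ ((hfin _ _).union (hfin _ _)) ((hfin2 _ _).union (hfin2 _ _)),
    Set.ncard_union_eq _ (hfin _ _) (hfin _ _), Set.ncard_union_eq _ (hfin2 _ _) (hfin2 _ _),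
    ncard_squarefree_emod_four X (.inl rfl), ncard_squarefree_emod_four _ (.inr rfl),
    ncard_squarefree_even _ (.inl rfl), ncard_squarefree_even _ (.inr rfl),
    div_div, show (4 : ℝ) * 2 = 8 by norm_num, two_mul]
  all_goals
    refine Set.disjoint_left.2 fun d hd hd' ↦ ?_
    simp only [Set.mem_ofPred_eq, Set.mem_union] at hd hd'
    grind

theorem abs_ncard_squarefree_abs_disc_lt_sub_le {X : ℝ} (hX : 1 ≤ X) :
    |({d : ℤ | Squarefree d ∧ d ≠ 1 ∧ |(QuadraticExt.disc d : ℝ)| < X}.ncard : ℝ) -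
      6 / Real.pi ^ 2 * X| ≤ 13 * √X := by
  have hle : {d : ℤ | Squarefree d ∧ d ≠ 1 ∧ |(QuadraticExt.disc d : ℝ)| < X}.ncard ≤
        {d : ℤ | Squarefree d ∧ |(QuadraticExt.disc d : ℝ)| < X}.ncard ∧
      {d : ℤ | Squarefree d ∧ |(QuadraticExt.disc d : ℝ)| < X}.ncard ≤
        {d : ℤ | Squarefree d ∧ d ≠ 1 ∧ |(QuadraticExt.disc d : ℝ)| < X}.ncard + 1 := by
    have hdiff : {d : ℤ | Squarefree d ∧ d ≠ 1 ∧ |(QuadraticExt.disc d : ℝ)| < X} =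
        {d : ℤ | Squarefree d ∧ |(QuadraticExt.disc d : ℝ)| < X} \ {1} := by
      ext d
      simp
      tauto
    rw [hdiff]
    exact ⟨Set.ncard_sdiff_singleton_le _ _, by
      simpa using Set.ncard_le_ncard_sdiff_add_ncard
        {d : ℤ | Squarefree d ∧ |(QuadraticExt.disc d : ℝ)| < X} {1}⟩
  rw [ncard_squarefree_abs_disc_lt] at hle
  generalize Set.ncard _ = N at hle ⊢
  obtain ⟨hle1, hle2⟩ := hle
  rify at hle1 hle2
  have hs : 1 ≤ √X := Real.one_le_sqrt.2 hX
  have h1 := abs_le.1 (abs_card_oddSquarefree_sub_le (X := X) (by linarith))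
  have h4 := abs_le.1 (abs_card_oddSquarefree_sub_le (X := X / 4) (by linarith))
  have h8 := abs_le.1 (abs_card_oddSquarefree_sub_le (X := X / 8) (by linarith))
  have hs4 : √(X / 4) ≤ √X := Real.sqrt_le_sqrt (by linarith)
  have hs8 : √(X / 8) ≤ √X := Real.sqrt_le_sqrt (by linarith)
  have hmain : 6 / Real.pi ^ 2 * X = 4 / Real.pi ^ 2 * X + 4 / Real.pi ^ 2 * (X / 4) +
      2 * (4 / Real.pi ^ 2 * (X / 8)) := by ring
  rw [hmain, abs_le]
  constructor <;> linarith

/-- Counting quadratic fields: `N₂(X) = (6/π²) X + O(√X)`. -/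
theorem quadratic_count :
    ∃ C : ℝ, ∀ X : ℝ, 1 ≤ X →
      |(countQuadratic X : ℝ) - 6 / Real.pi ^ 2 * X| ≤ C * Real.sqrt X := by
  refine ⟨13, fun X hX ↦ ?_⟩
  rw [countQuadratic_eq_ncard]
  exact abs_ncard_squarefree_abs_disc_lt_sub_le hX
end
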